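/- For every x in the interval [1/3, 1/2] and every y with φ ≤ y ≤ x, it holds that P(pile(y)) + Q(1 − x) + (x − pile(y))·ξ(x) + T(x,y) ≥ R. -/

import Mathlib

open Real

noncomputable def R : ℝ := 1 / (1 + Real.log 2)

noncomputable def f (x : ℝ) : ℝ :=
  if x ≤ R then 1/2 else (2 * Real.exp 1) ^ (x - 1)

noncomputable def F (x : ℝ) : ℝ :=
  if x ≤ R then x/2 else R * (2 * Real.exp 1) ^ (x - 1)

noncomputable def P (c : ℝ) : ℝ := ∫ y in (0:ℝ)..1, min (f y) c

noncomputable def Q (c : ℝ) : ℝ := ∫ y in (0:ℝ)..1, max (c - f y) 0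

noncomputable def xic : ℝ := (1 + (2/3) * Real.log (4/3)) * R - 2/3

noncomputable def phi : ℝ := (2/3) * xic / (2/3 - R + xic)

noncomputable def xi (x : ℝ) : ℝ :=
  if x ≤ 1/3 then xic / x else 9 * xic * (1 - 2 * x)

noncomputable def T (a b : ℝ) : ℝ := (a + b - 1/2) * (xi b - xi a)

noncomputable def pile (x : ℝ) : ℝ := max (2/3) (2 * x)

theorem one_add_log_two_pos : 0 < 1 + Real.log 2 := by
  have := Real.log_two_gt_d9
  linarith

theorem R_pos : 0 < R := one_div_pos.2 one_add_log_two_pos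

theorem R_mul_one_add_log_two : R * (1 + Real.log 2) = 1 :=
  one_div_mul_cancel one_add_log_two_pos.ne'

theorem two_mul_exp_one_rpow (s : ℝ) :
    (2 * Real.exp 1) ^ s = Real.exp ((1 + Real.log 2) * s) := by
  rw [Real.rpow_def_of_pos (by positivity), Real.log_mul two_ne_zero (Real.exp_ne_zero 1),
    Real.log_exp, add_comm]

theorem f_eq_half {y : ℝ} (hy : y ≤ R) : f y = 1 / 2 := if_pos hy

theorem f_eq_exp {y : ℝ} (hy : R ≤ y) : f y = Real.exp ((1 + Real.log 2) * (y - 1)) := by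
  rcases hy.eq_or_lt with rfl | h
  · have h : (1 + Real.log 2) * (R - 1) = -Real.log 2 := by
      linear_combination R_mul_one_add_log_two
    rw [f_eq_half le_rfl, h, Real.exp_neg, Real.exp_log two_pos, one_div]
  · rw [f, if_neg h.not_ge, two_mul_exp_one_rpow]

theorem f_eq_max (y : ℝ) : f y = max (1 / 2) (Real.exp ((1 + Real.log 2) * (y - 1))) := by
  have hR : f R = 1 / 2 := f_eq_half le_rfl
  rw [f_eq_exp le_rfl] at hR
  rcases le_total y R with h | h
  · rw [f_eq_half h, max_eq_left]
    rw [← hR]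
    gcongr
  · rw [f_eq_exp h, max_eq_right]
    rw [← hR]
    gcongr

theorem continuous_f : Continuous f := by
  rw [funext f_eq_max]
  fun_prop

theorem P_eq {c : ℝ} (hc : 1 / 2 ≤ c) (hc1 : c ≤ 1) : P c = R * c * (1 - Real.log c) := by
  have hc0 : 0 < c := by linarith
  have hLR := R_mul_one_add_log_two
  have hR0 := R_pos
  have hlog0 : Real.log c ≤ 0 := Real.log_nonpos hc0.le hc1
  have hlogh : -Real.log 2 ≤ Real.log c := by
    rw [← Real.log_inv]
    exact Real.log_le_log (by norm_num) (by linarith)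
  set t := 1 + R * Real.log c with ht
  have hRt : R ≤ t := by nlinarith
  have ht1 : t ≤ 1 := by nlinarith
  have htc : Real.exp ((1 + Real.log 2) * (t - 1)) = c := by
    rw [show (1 + Real.log 2) * (t - 1) = Real.log c by
      rw [ht]; linear_combination Real.log c * hLR, Real.exp_log hc0]
  have hi : ∀ a b : ℝ, IntervalIntegrable (fun y => min (f y) c) MeasureTheory.volume a b :=
    fun a b => (continuous_f.min continuous_const).intervalIntegrable a b
  have h1 : ∫ y in (0:ℝ)..R, min (f y) c = R / 2 := by
    rw [intervalIntegral.integral_congr (g := fun _ => (1 / 2 : ℝ))]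
    · simp; ring
    · intro y hy
      rw [Set.uIcc_of_le hR0.le] at hy
      simp only [f_eq_half hy.2, min_eq_left hc]
  have h2 : ∫ y in R..t, min (f y) c = R * c - R / 2 := by
    rw [intervalIntegral.integral_congr
      (g := fun y => Real.exp ((1 + Real.log 2) * (y - 1)))]
    · have hd : ∀ y ∈ Set.uIcc R t, HasDerivAt
          (fun y => R * Real.exp ((1 + Real.log 2) * (y - 1)))
          (Real.exp ((1 + Real.log 2) * (y - 1))) y := by
        intro y _
        have h := ((((hasDerivAt_id y).sub_const 1).const_mul
          (1 + Real.log 2)).exp).const_mul R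
        refine h.congr_deriv ?_
        simp only [id]
        linear_combination Real.exp ((1 + Real.log 2) * (y - 1)) * hLR
      rw [intervalIntegral.integral_eq_sub_of_hasDerivAt hd
        (Continuous.intervalIntegrable (by fun_prop) _ _), htc, ← f_eq_exp le_rfl,
        f_eq_half le_rfl]
      ring
    · intro y hy
      rw [Set.uIcc_of_le hRt] at hy
      simp only [f_eq_exp hy.1]
      refine min_eq_left ?_
      conv_rhs => rw [← htc]
      have := hy.2
      gcongr
  have h3 : ∫ y in t..1, min (f y) c = (1 - t) * c := by
    rw [intervalIntegral.integral_congr (g := fun _ => c)]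
    · simp
    · intro y hy
      rw [Set.uIcc_of_le ht1] at hy
      simp only [f_eq_exp (hRt.trans hy.1)]
      refine min_eq_right ?_
      conv_lhs => rw [← htc]
      have := hy.1
      gcongr
  rw [P, ← intervalIntegral.integral_add_adjacent_intervals (hi 0 t) (hi t 1),
    ← intervalIntegral.integral_add_adjacent_intervals (hi 0 R) (hi R t), h1, h2, h3, ht]
  ring

theorem Q_eq_sub_P (c : ℝ) : Q c = c - P c := by
  have h : ∀ y, max (c - f y) 0 = c - min (f y) c := by
    intro y
    rw [← max_sub_sub_left, sub_self]
  simp only [Q, P, h]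
  rw [intervalIntegral.integral_sub _root_.intervalIntegrable_const
    ((continuous_f.min continuous_const).intervalIntegrable _ _)]
  simp

theorem mul_sub_half_le_Q {c : ℝ} (hc : 1 / 2 ≤ c) (hc1 : c ≤ 1) : R * (c - 1 / 2) ≤ Q c := by
  have hc0 : 0 < c := by linarith
  have h := Real.one_sub_inv_le_log_of_pos (show 0 < 2 * c by linarith)
  rw [Real.log_mul two_ne_zero hc0.ne'] at h
  have h' := mul_le_mul_of_nonneg_left h (mul_pos R_pos hc0).le
  have e : R * c * (1 - (2 * c)⁻¹) = R * c - R / 2 := by field_simp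
  rw [Q_eq_sub_P, P_eq hc hc1]
  linarith [congrArg (c * ·) R_mul_one_add_log_two]

theorem P_two_thirds : P (2 / 3) = R - xic := by
  have h : Real.log (4 / 3) = Real.log 2 + Real.log (2 / 3) := by
    rw [← Real.log_mul (by norm_num) (by norm_num)]
    norm_num
  rw [P_eq (by norm_num) (by norm_num), xic, h]
  linear_combination (2 / 3) * R_mul_one_add_log_two

/-- The chord bound from the concavity of `P` on `[2/3, 1]`. -/
theorem le_P {c : ℝ} (hc : 2 / 3 ≤ c) (hc1 : c ≤ 1) : R - 3 * (1 - c) * xic ≤ P c := by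
  have hconv := Real.convexOn_mul_log.2
    (show (1 : ℝ) ∈ Set.Ici 0 by norm_num) (show (2 / 3 : ℝ) ∈ Set.Ici 0 by norm_num)
    (show 0 ≤ 3 * c - 2 by linarith) (show 0 ≤ 3 * (1 - c) by linarith) (by ring)
  simp only [smul_eq_mul, Real.log_one] at hconv
  rw [show (3 * c - 2) * 1 + 3 * (1 - c) * (2 / 3) = c by ring] at hconv
  have h := P_two_thirds
  rw [P_eq (by norm_num) (by norm_num)] at h
  rw [P_eq (by linarith) hc1, show xic = R - R * (2 / 3) * (1 - Real.log (2 / 3)) by linarith]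
  linarith [mul_le_mul_of_nonneg_left hconv R_pos.le]

theorem log_four_thirds_le : Real.log (4 / 3) ≤ 7 / 24 := by
  have h : Real.log ((4 / 3) ^ 24) ≤ 7 := by
    rw [Real.log_le_iff_le_exp (by positivity)]
    have h1 : (2.7182818283 : ℝ) ^ 7 ≤ Real.exp 1 ^ 7 := by
      gcongr
      exact Real.exp_one_gt_d9.le
    rw [← Real.exp_nat_mul] at h1
    norm_num at h1 ⊢
    linarith
  rw [Real.log_pow] at h
  push_cast at h
  linarith

theorem R_lt_two_thirds : R < 2 / 3 := by
  nlinarith [R_mul_one_add_log_two, R_pos, Real.log_two_gt_d9]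

theorem xic_pos : 0 < xic := by
  have h := Real.one_sub_inv_le_log_of_pos (show (0:ℝ) < 4 / 3 by norm_num)
  norm_num at h
  rw [xic]
  nlinarith [R_mul_one_add_log_two, R_pos, Real.log_two_lt_d9]

theorem fifteen_mul_xic_le : 15 * xic ≤ R := by
  rw [xic]
  nlinarith [R_mul_one_add_log_two, R_pos, Real.log_two_gt_d9, log_four_thirds_le]

theorem xic_le_R_bound : 1 + 21 / 2 * xic ≤ 5 / 2 * R := by
  rw [xic]
  nlinarith [R_mul_one_add_log_two, R_pos, Real.log_two_gt_d9, log_four_thirds_le]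

theorem phi_pos : 0 < phi := by
  have := xic_pos
  have := R_lt_two_thirds
  exact div_pos (by linarith) (by linarith)

theorem xic_div_le {y : ℝ} (hy : phi ≤ y) : xic / y ≤ 3 / 2 * (2 / 3 - R + xic) := by
  have hx := xic_pos
  have hR := R_lt_two_thirds
  have hy0 := phi_pos.trans_le hy
  rw [phi, div_le_iff₀ (by linarith)] at hy
  rw [div_le_iff₀ hy0]
  linarith

theorem xi_eq {x : ℝ} (hx : 1 / 3 ≤ x) : xi x = 9 * xic * (1 - 2 * x) := by
  rcases hx.eq_or_lt with rfl | h
  · rw [xi, if_pos le_rfl]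
    ring
  · rw [xi, if_neg h.not_ge]

theorem stmt_16 : ∀ x ∈ Set.Icc (1/3 : ℝ) (1/2), ∀ y : ℝ, phi ≤ y → y ≤ x →
    P (pile y) + Q (1 - x) + (x - pile y) * xi x + T x y ≥ R := by
  rintro x ⟨hx1, hx2⟩ y hy hyx
  have hQ := mul_sub_half_le_Q (c := 1 - x) (by linarith) (by linarith)
  have hX := xic_pos
  have hu : 0 ≤ 1 / 2 - x := by linarith
  rw [T, xi_eq hx1]
  rcases le_total y (1 / 3) with h | h
  · have hy0 := phi_pos.trans_le hy
    have hk : xic * 3 + xic / y + 18 * xic * y ≤ R := by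
      nlinarith [xic_div_le hy, xic_le_R_bound, mul_le_mul_of_nonneg_left h hX.le]
    rw [pile, max_eq_left (by linarith), P_two_thirds, xi, if_pos h]
    have e : xic / y * y = xic := div_mul_cancel₀ _ hy0.ne'
    linarith [mul_nonneg hu (sub_nonneg.2 hk)]
  · rw [pile, max_eq_right (by linarith), xi_eq h]
    have hP := le_P (c := 2 * y) (by linarith) (by linarith)
    have h1 : 0 ≤ xic * ((x - y) * (y - 1 / 3)) :=
      mul_nonneg hX.le (mul_nonneg (by linarith) (by linarith))
    have h2 : 0 ≤ (1 / 2 - x) * (R - 15 * xic) :=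
      mul_nonneg hu (by linarith [fifteen_mul_xic_le])
    have h3 : 0 ≤ xic * ((1 / 2 - x) * (1 / 2 - y)) :=
      mul_nonneg hX.le (mul_nonneg hu (by linarith))
    linarith
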